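/- arXiv:1504.04195 — 3 statements merged into one kernel-verified Lean document; each statement's English description precedes it below -/
import Mathlib

section
/- For every integer n ≥ 10, μ(EP_n) > μ(EP'_n) > μ(K_{n−6}) = n − 7. -/
open SimpleGraph

/-- A graph is claw-free if it contains no induced `K_{1,3}`. -/
def ClawFree {V : Type*} (G : SimpleGraph V) : Prop :=
  ¬ ∃ v a b c : V, a ≠ b ∧ a ≠ c ∧ b ≠ c ∧
    G.Adj v a ∧ G.Adj v b ∧ G.Adj v c ∧ ¬ G.Adj a b ∧ ¬ G.Adj a c ∧ ¬ G.Adj b c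

/-- A graph is traceable if it has a Hamilton path. -/
def Traceable {V : Type*} (G : SimpleGraph V) : Prop := by
  classical
  exact ∃ (u v : V) (p : G.Walk u v), p.IsHamiltonian

/-- A graph is 2-connected if it has at least 3 vertices and deleting any
single vertex leaves a connected graph. -/
def TwoConnected {V : Type*} [Fintype V] (G : SimpleGraph V) : Prop :=
  3 ≤ Fintype.card V ∧ ∀ v : V, (G.induce ({v}ᶜ : Set V)).Connected

/-- A vertex is eligible if its neighbourhood induces a connected non-complete graph. -/
def Eligible {V : Type*} (G : SimpleGraph V) (x : V) : Prop :=
  (G.induce (G.neighborSet x)).Connected ∧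
    ∃ u v : V, G.Adj x u ∧ G.Adj x v ∧ u ≠ v ∧ ¬ G.Adj u v

/-- A claw-free graph is closed if it has no eligible vertex. -/
def IsClosedGraph {V : Type*} (G : SimpleGraph V) : Prop := ∀ x : V, ¬ Eligible G x

/-- The spectral radius of a graph: the largest eigenvalue of its adjacency matrix. -/
noncomputable def adjSpectralRadius {V : Type*} [Fintype V] (G : SimpleGraph V) : ℝ := by
  classical
  exact sSup {μ : ℝ | ∃ x : V → ℝ, x ≠ 0 ∧ (G.adjMatrix ℝ).mulVec x = μ • x}

/-- The `Q`-index of a graph: the largest eigenvalue of `Q = D + A`. -/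
noncomputable def qIndex {V : Type*} [Fintype V] (G : SimpleGraph V) : ℝ := by
  classical
  exact sSup {μ : ℝ | ∃ x : V → ℝ, x ≠ 0 ∧
    (Matrix.diagonal (fun v => (G.degree v : ℝ)) + G.adjMatrix ℝ).mulVec x = μ • x}

/-- `EN n`: the complete graph on `{0, …, n-4}` together with pendant vertices
`n-3, n-2, n-1` attached to `0, 1, 2` respectively. -/
def ENgraph (n : ℕ) : SimpleGraph (Fin n) :=
  SimpleGraph.fromRel (fun i j =>
    (i.val < n - 3 ∧ j.val < n - 3) ∨ j.val = i.val + (n - 3))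

/-- `EP n`: a clique on `{0,…,n-7}` with `a_i = i`, a triangle `b_i = n-6+i`,
and vertices `c_i = n-3+i` with edges `a_i b_i`, `a_i c_i`, `b_i c_i` (`i = 0,1,2`). -/
def EPgraph (n : ℕ) : SimpleGraph (Fin n) :=
  SimpleGraph.fromRel (fun i j =>
    (i.val < n - 6 ∧ j.val < n - 6) ∨
    (n - 6 ≤ i.val ∧ i.val < n - 3 ∧ n - 6 ≤ j.val ∧ j.val < n - 3) ∨
    (i.val < 3 ∧ (j.val = i.val + (n - 6) ∨ j.val = i.val + (n - 3))) ∨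
    (n - 6 ≤ i.val ∧ i.val < n - 3 ∧ j.val = i.val + 3))

/-- `EP' n`: a clique on `{0,…,n-7}` with `a₁ = 0`, `b₁ = 1`, `c₁ = 2`, triangles
`a₁a₂a₃` and `b₁b₂b₃` where `a₂ = n-6`, `a₃ = n-5`, `b₂ = n-4`, `b₃ = n-3`, and
vertices `c₂ = n-2`, `c₃ = n-1` with edges `a_i b_i`, `a_i c_i`, `b_i c_i` for `i = 2,3`. -/
def EP'graph (n : ℕ) : SimpleGraph (Fin n) :=
  SimpleGraph.fromRel (fun i j =>
    (i.val < n - 6 ∧ j.val < n - 6) ∨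
    (i.val = 0 ∧ (j.val = n - 6 ∨ j.val = n - 5)) ∨
    (i.val = 1 ∧ (j.val = n - 4 ∨ j.val = n - 3)) ∨
    (i.val = n - 6 ∧ (j.val = n - 5 ∨ j.val = n - 4 ∨ j.val = n - 2)) ∨
    (i.val = n - 5 ∧ (j.val = n - 3 ∨ j.val = n - 1)) ∨
    (i.val = n - 4 ∧ (j.val = n - 3 ∨ j.val = n - 2)) ∨
    (i.val = n - 3 ∧ j.val = n - 1))

/-- A positive vector `y` with `A y ≤ s y` bounds all adjacency eigenvalues by `s`. -/
theorem adjMatrix_eigenvalue_le {V : Type*} [Fintype V] (G : SimpleGraph V) [DecidableRel G.Adj]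
    {y : V → ℝ} {s : ℝ} (hy : ∀ v, 0 < y v) (h : ∀ v, (G.adjMatrix ℝ).mulVec y v ≤ s * y v)
    {μ : ℝ} {x : V → ℝ} (hx : x ≠ 0) (hμ : (G.adjMatrix ℝ).mulVec x = μ • x) : μ ≤ s := by
  obtain ⟨w, hw⟩ := Function.ne_iff.mp hx
  obtain ⟨v, -, hv⟩ := Finset.exists_max_image Finset.univ (fun v => |x v| / y v)
    ⟨w, Finset.mem_univ w⟩
  have hc : 0 < |x v| / y v :=
    (div_pos (abs_pos.mpr hw) (hy w)).trans_le (hv w (Finset.mem_univ w))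
  set c := |x v| / y v with hcdef
  have hle : ∀ u, |x u| ≤ c * y u := fun u => (div_le_iff₀ (hy u)).mp (hv u (Finset.mem_univ u))
  have hxv : |x v| = c * y v := by rw [hcdef, div_mul_cancel₀ _ (hy v).ne']
  have h1 : μ * |x v| ≤ c * (s * y v) := calc
    μ * |x v| ≤ |μ| * |x v| := by gcongr; exact le_abs_self μ
    _ = |∑ u ∈ G.neighborFinset v, x u| := by
      rw [← abs_mul, ← SimpleGraph.adjMatrix_mulVec_apply, hμ, Pi.smul_apply, smul_eq_mul]
    _ ≤ ∑ u ∈ G.neighborFinset v, c * y u :=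
      (Finset.abs_sum_le_sum_abs _ _).trans (Finset.sum_le_sum fun u _ => hle u)
    _ = c * (G.adjMatrix ℝ).mulVec y v := by
      rw [SimpleGraph.adjMatrix_mulVec_apply, Finset.mul_sum]
    _ ≤ c * (s * y v) := by gcongr; exact h v
  rw [hxv] at h1
  have : 0 < c * y v := mul_pos hc (hy v)
  nlinarith

theorem bddAbove_adjMatrix_eigenvalues {V : Type*} [Fintype V] (G : SimpleGraph V)
    [DecidableRel G.Adj] :
    BddAbove {μ : ℝ | ∃ x : V → ℝ, x ≠ 0 ∧ (G.adjMatrix ℝ).mulVec x = μ • x} := by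
  refine ⟨Fintype.card V, ?_⟩
  rintro μ ⟨x, hx, hμ⟩
  refine adjMatrix_eigenvalue_le G (y := fun _ => 1) (fun _ => one_pos) (fun v => ?_) hx hμ
  rw [SimpleGraph.adjMatrix_mulVec_apply]
  simpa using (G.degree_lt_card_verts v).le

/-- Adjacency eigenvector equation, written without choosing decidability instances. -/
def IsAdjEigenvector {V : Type*} [Fintype V] (G : SimpleGraph V) (s : ℝ) (y : V → ℝ) : Prop := by
  classical
  exact ∀ v, ∑ w, (if G.Adj v w then y w else 0) = s * y v

theorem IsAdjEigenvector.mulVec_eq {V : Type*} [Fintype V] {G : SimpleGraph V}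
    [DecidableRel G.Adj] {s : ℝ} {y : V → ℝ} (h : IsAdjEigenvector G s y) :
    (G.adjMatrix ℝ).mulVec y = s • y := by
  ext v
  have := h v
  simp only [Matrix.mulVec, dotProduct, SimpleGraph.adjMatrix_apply, ite_mul, one_mul, zero_mul,
    Pi.smul_apply, smul_eq_mul]
  convert this

theorem IsAdjEigenvector.le_adjSpectralRadius {V : Type*} [Fintype V] {G : SimpleGraph V}
    {s : ℝ} {y : V → ℝ} (h : IsAdjEigenvector G s y) (hy : y ≠ 0) :
    s ≤ adjSpectralRadius G := by
  classical
  unfold adjSpectralRadius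
  exact le_csSup (bddAbove_adjMatrix_eigenvalues G) ⟨y, hy, h.mulVec_eq⟩

/-- An eigenvalue with a positive eigenvector is the spectral radius. -/
theorem IsAdjEigenvector.adjSpectralRadius_eq {V : Type*} [Fintype V] [Nonempty V]
    {G : SimpleGraph V} {s : ℝ} {y : V → ℝ} (h : IsAdjEigenvector G s y) (hy : ∀ v, 0 < y v) :
    adjSpectralRadius G = s := by
  classical
  have hy0 : y ≠ 0 := fun h0 => by
    have := hy (Classical.arbitrary V)
    simp [h0] at this
  refine le_antisymm ?_ (h.le_adjSpectralRadius hy0)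
  unfold adjSpectralRadius
  refine csSup_le ⟨s, y, hy0, h.mulVec_eq⟩ ?_
  rintro μ ⟨x, hx, hμ⟩
  refine adjMatrix_eigenvalue_le G hy (fun v => ?_) hx hμ
  rw [h.mulVec_eq, Pi.smul_apply, smul_eq_mul]

theorem adjSpectralRadius_top (m : ℕ) (hm : 0 < m) :
    adjSpectralRadius (⊤ : SimpleGraph (Fin m)) = (m : ℝ) - 1 := by
  have : Nonempty (Fin m) := ⟨⟨0, hm⟩⟩
  refine IsAdjEigenvector.adjSpectralRadius_eq (y := fun _ => 1) (fun v => ?_) (fun _ => one_pos)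
  simp only [SimpleGraph.top_adj, mul_one, ← Finset.sum_filter, Finset.filter_ne]
  simp [Nat.cast_sub (Nat.one_le_iff_ne_zero.mpr hm.ne')]

/-- Splits a sum over `k + 9` vertices into three first, `k` middle and six last ones. -/
theorem sum_fin_add_nine (k : ℕ) (f : ℕ → ℝ) :
    ∑ w : Fin (k + 9), f w.val = f 0 + f 1 + f 2 + (∑ j ∈ Finset.range k, f (j + 3)) +
      f (k + 3) + f (k + 4) + f (k + 5) + f (k + 6) + f (k + 7) + f (k + 8) := by
  rw [Fin.sum_univ_eq_sum_range]
  simp only [Finset.sum_range_succ, Finset.sum_range_succ' _ (k + 2),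
    Finset.sum_range_succ' _ (k + 1), Finset.sum_range_succ' _ k]
  ring

theorem sum_range_ite_ne (k i : ℕ) (hi : i < k) (c : ℝ) :
    ∑ j ∈ Finset.range k, (if i ≠ j then c else 0) = (k - 1) * c := by
  rw [← Finset.sum_filter, Finset.filter_ne]
  have : 1 ≤ k := by omega
  simp [Finset.card_erase_of_mem, hi, Nat.cast_sub this]

/-- The part of the adjacency sum at `i` coming from the three first and six last of `k + 9`
vertices. -/
noncomputable def outerSum (k : ℕ) (R : ℕ → ℕ → Prop) (w : ℕ → ℝ) (i : ℕ) : ℝ := by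
  classical
  exact (if R i 0 then w 0 else 0) + (if R i 1 then w 1 else 0) + (if R i 2 then w 2 else 0) +
    (if R i (k + 3) then w (k + 3) else 0) + (if R i (k + 4) then w (k + 4) else 0) +
    (if R i (k + 5) then w (k + 5) else 0) + (if R i (k + 6) then w (k + 6) else 0) +
    (if R i (k + 7) then w (k + 7) else 0) + (if R i (k + 8) then w (k + 8) else 0)

/-- Eigenvector criterion for a graph on `k + 9` vertices whose first `k + 3` vertices form a
clique, the vertices `3, …, k + 2` having equal weight and no neighbours outside the clique. -/
theorem isAdjEigenvector_of_clique {k : ℕ} {G : SimpleGraph (Fin (k + 9))} {R : ℕ → ℕ → Prop}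
    {w : ℕ → ℝ} {s x : ℝ} (hG : ∀ u v, G.Adj u v ↔ R u.val v.val)
    (hR : ∀ i, ∀ j < k, R i (j + 3) ↔ i < k + 3 ∧ i ≠ j + 3) (hw : ∀ j < k, w (j + 3) = x)
    (hfirst : ∀ i < 3, outerSum k R w i + k * x = s * w i)
    (hmid : ∀ i < k, outerSum k R w (i + 3) + (k - 1) * x = s * x)
    (hlast : ∀ i < 6, outerSum k R w (k + 3 + i) = s * w (k + 3 + i)) :
    IsAdjEigenvector G s (fun v => w v.val) := by
  classical
  rintro ⟨v, hv⟩
  simp only [hG]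
  rw [sum_fin_add_nine k (fun j => if R v j then w j else 0)]
  have hsum : ∑ j ∈ Finset.range k, (if R v (j + 3) then w (j + 3) else 0) =
      ∑ j ∈ Finset.range k, (if v < k + 3 ∧ v ≠ j + 3 then x else 0) :=
    Finset.sum_congr rfl fun j hj => by
      simp only [hR v j (Finset.mem_range.mp hj), hw j (Finset.mem_range.mp hj)]
  rw [hsum]
  by_cases h3 : v < 3
  · have h : ∑ j ∈ Finset.range k, (if v < k + 3 ∧ v ≠ j + 3 then x else 0) = k * x := by
      rw [Finset.sum_congr rfl fun j _ => if_pos (by omega)]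
      simp
    rw [h, ← hfirst v h3]
    unfold outerSum
    ring
  by_cases hk : v < k + 3
  · obtain ⟨i, rfl⟩ := Nat.exists_eq_add_of_le' (not_lt.mp h3)
    have hi : i < k := by omega
    have h := sum_range_ite_ne k i hi x
    simp only [hk, true_and, ne_eq, Nat.add_right_cancel_iff] at h ⊢
    rw [h, hw i hi, ← hmid i hi]
    unfold outerSum
    ring
  · obtain ⟨i, rfl⟩ := Nat.exists_eq_add_of_le (not_lt.mp hk)
    have h : ∑ j ∈ Finset.range k, (if k + 3 + i < k + 3 ∧ k + 3 + i ≠ j + 3 then x else 0) = 0 :=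
      Finset.sum_eq_zero fun j _ => if_neg (by omega)
    rw [h, ← hlast i (by omega)]
    unfold outerSum
    ring

/-- A vertex weighting of `EP (k + 9)`: `a` on the `a_i`, `x` on the other clique vertices,
`b` on the `b_i` and `c` on the `c_i`. -/
noncomputable def epWeight (k : ℕ) (a x b c : ℝ) (i : ℕ) : ℝ :=
  if i < 3 then a else if i < k + 3 then x else if i < k + 6 then b else c

/-- A vertex weighting of `EP' (k + 9)`: `p` on `a₁, b₁`, `x` on the other clique vertices,
`q` on `a₂, a₃, b₂, b₃` and `r` on `c₂, c₃`. -/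
noncomputable def epPrimeWeight (k : ℕ) (p x q r : ℝ) (i : ℕ) : ℝ :=
  if i < 2 then p else if i < k + 3 then x else if i < k + 7 then q else r

theorem isAdjEigenvector_EPgraph (k : ℕ) {s a x b c : ℝ}
    (ha : 2 * a + k * x + b + c = s * a) (hx : 3 * a + (k - 1) * x = s * x)
    (hb : a + 2 * b + c = s * b) (hc : a + b = s * c) :
    IsAdjEigenvector (EPgraph (k + 9)) s (fun v => epWeight k a x b c v.val) := by
  let Q : ℕ → ℕ → Prop := fun i j =>
    (i < k + 3 ∧ j < k + 3) ∨ (k + 3 ≤ i ∧ i < k + 6 ∧ k + 3 ≤ j ∧ j < k + 6) ∨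
    (i < 3 ∧ (j = i + (k + 3) ∨ j = i + (k + 6))) ∨ (k + 3 ≤ i ∧ i < k + 6 ∧ j = i + 3)
  refine isAdjEigenvector_of_clique (R := fun i j => i ≠ j ∧ (Q i j ∨ Q j i))
    (w := epWeight k a x b c) (x := x) (fun u v => ?_) (fun i j hj => ?_) (fun j hj => ?_)
    (fun i hi => ?_) (fun i hi => ?_) (fun i hi => ?_)
  · simp only [EPgraph, SimpleGraph.fromRel_adj, Q, ne_eq, Fin.ext_iff,
      show k + 9 - 6 = k + 3 from rfl, show k + 9 - 3 = k + 6 from rfl]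
  · simp only [Q]
    omega
  · simp (disch := omega) only [epWeight, if_pos, if_neg]
  · interval_cases i <;>
      simp (disch := omega) only [outerSum, Q, epWeight, if_pos, if_neg] <;>
      linarith
  · simp (disch := omega) only [outerSum, Q, epWeight, if_pos, if_neg]
    linarith
  · interval_cases i <;>
      simp (disch := omega) only [outerSum, Q, epWeight, and_true, if_pos, if_neg] <;>
      linarith

theorem isAdjEigenvector_EPPrimegraph (k : ℕ) {s p x q r : ℝ}
    (hp : p + (k + 1) * x + 2 * q = s * p) (hx : 2 * p + k * x = s * x)
    (hq : p + 2 * q + r = s * q) (hr : 2 * q = s * r) :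
    IsAdjEigenvector (EP'graph (k + 9)) s (fun v => epPrimeWeight k p x q r v.val) := by
  let Q : ℕ → ℕ → Prop := fun i j =>
    (i < k + 3 ∧ j < k + 3) ∨
    (i = 0 ∧ (j = k + 3 ∨ j = k + 4)) ∨
    (i = 1 ∧ (j = k + 5 ∨ j = k + 6)) ∨
    (i = k + 3 ∧ (j = k + 4 ∨ j = k + 5 ∨ j = k + 7)) ∨
    (i = k + 4 ∧ (j = k + 6 ∨ j = k + 8)) ∨
    (i = k + 5 ∧ (j = k + 6 ∨ j = k + 7)) ∨
    (i = k + 6 ∧ j = k + 8)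
  refine isAdjEigenvector_of_clique (R := fun i j => i ≠ j ∧ (Q i j ∨ Q j i))
    (w := epPrimeWeight k p x q r) (x := x) (fun u v => ?_) (fun i j hj => ?_) (fun j hj => ?_)
    (fun i hi => ?_) (fun i hi => ?_) (fun i hi => ?_)
  · simp only [EP'graph, SimpleGraph.fromRel_adj, Q, ne_eq, Fin.ext_iff,
      show k + 9 - 6 = k + 3 from rfl, show k + 9 - 5 = k + 4 from rfl,
      show k + 9 - 4 = k + 5 from rfl, show k + 9 - 3 = k + 6 from rfl,
      show k + 9 - 2 = k + 7 from rfl, show k + 9 - 1 = k + 8 from rfl]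
  · simp only [Q]
    omega
  · simp (disch := omega) only [epPrimeWeight, if_pos, if_neg]
  · interval_cases i <;>
      simp (disch := omega) only [outerSum, Q, epPrimeWeight, true_and, and_true, true_or, or_true,
        if_pos, if_neg] <;>
      linarith
  · simp (disch := omega) only [outerSum, Q, epPrimeWeight, if_pos, if_neg]
    linarith
  · interval_cases i <;>
      simp (disch := omega) only [outerSum, Q, epPrimeWeight, true_and, and_true, true_or, or_true,
        if_pos, if_neg] <;>
      linarith

/-- The equation for the spectral radius of `EP' (k + 9)` has a root above `k + 2`. -/
theorem exists_EPPrime_root (k : ℕ) (hk : 1 ≤ k) :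
    ∃ s : ℝ, (k : ℝ) + 2 < s ∧ s < k + 4 ∧ 0 < s ^ 2 - 3 * s + k - 2 ∧
      (s + 1) * (s - k - 2) * (s ^ 2 - 2 * s - 2) = 2 * s * (s - k) := by
  have hk1 : (1 : ℝ) ≤ k := by exact_mod_cast hk
  let F : ℝ → ℝ := fun s => (s + 1) * (s - k - 2) * (s ^ 2 - 2 * s - 2) - 2 * s * (s - k)
  have hF : Continuous F := by fun_prop
  have hroot : ∀ l : ℝ, l ≤ k + 4 → F l < 0 → ∃ s, l < s ∧ s < k + 4 ∧ F s = 0 := by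
    intro l hl hneg
    have hpos : 0 < F (k + 4) := by
      simp only [F]; ring_nf; nlinarith [pow_pos (zero_lt_one.trans_le hk1) 3]
    obtain ⟨s, hs, h0⟩ := intermediate_value_Ioo hl hF.continuousOn ⟨hneg, hpos⟩
    exact ⟨s, hs.1, hs.2, h0⟩
  rcases hk.eq_or_lt with rfl | hk2
  · obtain ⟨s, h1, h2, h3⟩ := hroot (10 / 3) (by norm_num) (by simp only [F]; norm_num)
    refine ⟨s, ?_, h2, ?_, sub_eq_zero.mp h3⟩
    · push_cast; linarith
    · push_cast; nlinarith
  · have hk2 : (2 : ℝ) ≤ k := by exact_mod_cast hk2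
    obtain ⟨s, h1, h2, h3⟩ := hroot (k + 2) (by linarith) (by simp only [F]; ring_nf; linarith)
    exact ⟨s, h1, h2, by nlinarith, sub_eq_zero.mp h3⟩

/-- Above a root of the equation for `EP' (k + 9)` lies a root of the equation for `EP (k + 9)`. -/
theorem exists_EP_root_gt (k : ℕ) (hk : 1 ≤ k) {s : ℝ} (hs : (k : ℝ) + 2 < s) (hs4 : s < k + 4)
    (hs0 : 0 < s ^ 2 - 3 * s + k - 2)
    (hroot : (s + 1) * (s - k - 2) * (s ^ 2 - 2 * s - 2) = 2 * s * (s - k)) :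
    ∃ t : ℝ, s < t ∧
      (t + 1) * (t - k - 2) * (t ^ 2 - 2 * t - 1) = 2 * t * (t - k + 1) := by
  have hk1 : (1 : ℝ) ≤ k := by exact_mod_cast hk
  let F : ℝ → ℝ := fun s => (s + 1) * (s - k - 2) * (s ^ 2 - 2 * s - 1) - 2 * s * (s - k + 1)
  have hF : Continuous F := by fun_prop
  have hpos : 0 < F (k + 4) := by
    simp only [F]; ring_nf; nlinarith [pow_pos (zero_lt_one.trans_le hk1) 3]
  have hneg : F s < 0 := by
    have h : F s = (s + 1) * (s - k - 2) - 2 * s := by simp only [F]; linear_combination hroot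
    have hX : 0 < s ^ 2 - 2 * s - 2 := by nlinarith
    have : F s * (s ^ 2 - 2 * s - 2) = -(2 * s * (s ^ 2 - 3 * s + k - 2)) := by
      rw [h]; linear_combination hroot
    have h2 : 0 < 2 * s * (s ^ 2 - 3 * s + k - 2) := mul_pos (by linarith) hs0
    by_contra hcon
    have := mul_nonneg (not_lt.mp hcon) hX.le
    linarith
  obtain ⟨t, ht, h0⟩ := intermediate_value_Ioo hs4.le hF.continuousOn ⟨hneg, hpos⟩
  exact ⟨t, ht.1, sub_eq_zero.mp h0⟩

theorem statement_10 (n : ℕ) (hn : 10 ≤ n) :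
    adjSpectralRadius (EPgraph n) > adjSpectralRadius (EP'graph n) ∧
    adjSpectralRadius (EP'graph n) > adjSpectralRadius (⊤ : SimpleGraph (Fin (n - 6))) ∧
    adjSpectralRadius (⊤ : SimpleGraph (Fin (n - 6))) = (n : ℝ) - 7 := by
  obtain ⟨k, rfl⟩ := Nat.exists_eq_add_of_le' (show 9 ≤ n by omega)
  have hk : 1 ≤ k := by omega
  have hk1 : (1 : ℝ) ≤ k := by exact_mod_cast hk
  have htop : adjSpectralRadius (⊤ : SimpleGraph (Fin (k + 9 - 6))) = ((k + 9 : ℕ) : ℝ) - 7 := by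
    rw [adjSpectralRadius_top _ (by omega), show k + 9 - 6 = k + 3 from rfl]
    push_cast; ring
  obtain ⟨s, hs, hs4, hs0, hsroot⟩ := exists_EPPrime_root k hk
  obtain ⟨t, hst, htroot⟩ := exists_EP_root_gt k hk hs hs4 hs0 hsroot
  have hX : 0 < s ^ 2 - 2 * s - 2 := by nlinarith
  have hsk : 0 < s - k := by linarith
  have htk : 0 < t - k + 1 := by linarith
  have hEP' : adjSpectralRadius (EP'graph (k + 9)) = s := by
    refine (isAdjEigenvector_EPPrimegraph k (p := s ^ 2 - 2 * s - 2)
      (x := 2 * (s ^ 2 - 2 * s - 2) / (s - k)) (q := s) (r := 2)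
      ?_ ?_ ?_ ?_).adjSpectralRadius_eq fun v => ?_
    · field_simp
      linear_combination -hsroot
    · field_simp
      ring
    · ring
    · ring
    · have : 0 < 2 * (s ^ 2 - 2 * s - 2) / (s - k) := by positivity
      unfold epPrimeWeight
      split_ifs <;> linarith
  have hEP : t ≤ adjSpectralRadius (EPgraph (k + 9)) := by
    refine (isAdjEigenvector_EPgraph k (a := t ^ 2 - 2 * t - 1)
      (x := 3 * (t ^ 2 - 2 * t - 1) / (t - k + 1)) (b := t + 1) (c := t - 1)
      ?_ ?_ ?_ ?_).le_adjSpectralRadius fun h0 => ?_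
    · field_simp
      linear_combination -htroot
    · field_simp
      ring
    · ring
    · ring
    · have := congrFun h0 (Fin.last (k + 8))
      simp [epWeight, show ¬ k + 8 < 3 by omega] at this
      linarith
  refine ⟨?_, ?_, htop⟩
  · rw [hEP']
    exact hst.trans_le hEP
  · rw [hEP', htop]
    push_cast
    linarith
end

section
/- For every integer n ≥ 10, μ(the complement of EP'_n) < μ(the complement of EP_n) < μ(K_6 ∨ (n−6)K_1) = (5 + √(24n − 119))/2, where K_6 ∨ (n−6)K_1 is the join of a complete graph on 6 vertices with n−6 isolated vertices. -/
open SimpleGraph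

/-- The join `K₆ ∨ (n-6)K₁`: the first six vertices form a clique and are
joined to all other vertices; the remaining `n - 6` vertices are independent. -/
def K6JoinEmpty (n : ℕ) : SimpleGraph (Fin n) :=
  SimpleGraph.fromRel (fun i j => i.val < 6 ∨ j.val < 6)

/-- A positive eigenvector of the adjacency matrix belongs to the spectral radius. -/
theorem adjSpectralRadius_eq_of_pos_eigenvector {V : Type*} [Fintype V] [Nonempty V]
    (G : SimpleGraph V) [DecidableRel G.Adj] {x : V → ℝ} {μ : ℝ} (hx : ∀ i, 0 < x i)
    (h : ∀ i, ∑ j, (if G.Adj i j then x j else 0) = μ * x i) :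
    adjSpectralRadius G = μ := by
  unfold adjSpectralRadius
  refine IsGreatest.csSup_eq ⟨⟨x, ?_, ?_⟩, ?_⟩
  · intro h0
    obtain ⟨v⟩ := ‹Nonempty V›
    exact (hx v).ne' (congrFun h0 v)
  · funext i
    simp only [Matrix.mulVec, dotProduct, adjMatrix_apply, ite_mul, one_mul, zero_mul,
      Pi.smul_apply, smul_eq_mul]
    rw [← h i]
  · rintro ν ⟨y, hy0, hy⟩
    obtain ⟨i, -, hi⟩ := Finset.exists_max_image Finset.univ (fun j => |y j| / x j)
      Finset.univ_nonempty
    set t := |y i| / x i with ht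
    have hle : ∀ j, |y j| ≤ t * x j := fun j =>
      (div_le_iff₀ (hx j)).1 (hi j (Finset.mem_univ j))
    have hti : t * x i = |y i| := div_mul_cancel₀ _ (hx i).ne'
    have hyi : 0 < |y i| := by
      obtain ⟨j, hj⟩ := Function.ne_iff.1 hy0
      have hjpos : 0 < |y j| := abs_pos.2 hj
      have htpos : 0 < t := pos_of_mul_pos_left (hjpos.trans_le (hle j)) (hx j).le
      rw [← hti]
      exact mul_pos htpos (hx i)
    have hyeq : ∑ j, (if G.Adj i j then y j else 0) = ν * y i := by
      have := congrFun hy i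
      simp only [Matrix.mulVec, dotProduct, adjMatrix_apply, ite_mul, one_mul, zero_mul,
        Pi.smul_apply, smul_eq_mul] at this
      rw [← this]
    have key : |ν| * |y i| ≤ μ * |y i| := by
      calc |ν| * |y i| = |∑ j, (if G.Adj i j then y j else 0)| := by rw [hyeq, abs_mul]
        _ ≤ ∑ j, |if G.Adj i j then y j else 0| := Finset.abs_sum_le_sum_abs _ _
        _ ≤ ∑ j, t * (if G.Adj i j then x j else 0) := by
          refine Finset.sum_le_sum fun j _ => ?_
          split_ifs
          · exact hle j
          · simp
        _ = μ * |y i| := by rw [← Finset.mul_sum, h i, ← hti]; ring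
    exact (le_abs_self ν).trans (le_of_mul_le_mul_right key hyi)

theorem adjSpectralRadius_eq_of_range_sum {n : ℕ} (hn : 0 < n) (G : SimpleGraph (Fin n))
    (R : ℕ → ℕ → Prop) [DecidableRel R] (hR : ∀ i j : Fin n, G.Adj i j ↔ R i j)
    {w : ℕ → ℝ} {μ : ℝ} (hw : ∀ i < n, 0 < w i)
    (h : ∀ i < n, ∑ j ∈ Finset.range n, (if R i j then w j else 0) = μ * w i) :
    adjSpectralRadius G = μ := by
  classical
  have : Nonempty (Fin n) := ⟨⟨0, hn⟩⟩
  refine adjSpectralRadius_eq_of_pos_eigenvector G (x := fun i => w i)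
    (fun i => hw i i.2) fun i => ?_
  rw [← h i i.2, ← Fin.sum_univ_eq_sum_range (fun j => if R i j then w j else 0)]
  exact Finset.sum_congr rfl fun j _ => by simp only [hR]

theorem sum_range_add_nine (k : ℕ) (F : ℕ → ℝ) (v : ℝ) (hF : ∀ t < k, F (t + 3) = v) :
    ∑ j ∈ Finset.range (k + 9), F j = F 0 + F 1 + F 2 + k * v +
      F (k + 3) + F (k + 4) + F (k + 5) + F (k + 6) + F (k + 7) + F (k + 8) := by
  have hmid : ∑ t ∈ Finset.range k, F (t + 3) = k * v := by
    rw [Finset.sum_congr rfl fun t ht => hF t (Finset.mem_range.1 ht)]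
    simp
  rw [show k + 9 = k + 3 + 6 from rfl]
  simp only [Finset.sum_range_succ _ (k + 8), Finset.sum_range_succ _ (k + 7),
    Finset.sum_range_succ _ (k + 6), Finset.sum_range_succ _ (k + 5),
    Finset.sum_range_succ _ (k + 4), Finset.sum_range_succ _ (k + 3)]
  rw [Finset.sum_range_succ', Finset.sum_range_succ', Finset.sum_range_succ', ← hmid]
  ring

theorem adjSpectralRadius_compl_EPgraph (k : ℕ) {r : ℝ} (hr : 0 < r)
    (hroot : r ^ 3 - 2 * r ^ 2 - (6 * k + 12) * r - (6 * k + 8) = 0) :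
    adjSpectralRadius (EPgraph (k + 9))ᶜ = r := by
  refine adjSpectralRadius_eq_of_range_sum (by omega) _
    (fun i j => i ≠ j ∧ ¬ (((i < k + 3 ∧ j < k + 3) ∨
      (k + 3 ≤ i ∧ i < k + 6 ∧ k + 3 ≤ j ∧ j < k + 6) ∨
      (i < 3 ∧ (j = i + (k + 3) ∨ j = i + (k + 6))) ∨
      (k + 3 ≤ i ∧ i < k + 6 ∧ j = i + 3)) ∨
      ((j < k + 3 ∧ i < k + 3) ∨
      (k + 3 ≤ j ∧ j < k + 6 ∧ k + 3 ≤ i ∧ i < k + 6) ∨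
      (j < 3 ∧ (i = j + (k + 3) ∨ i = j + (k + 6))) ∨
      (k + 3 ≤ j ∧ j < k + 6 ∧ i = j + 3)))) ?_
    (w := fun j => if j < 3 then 4 * r + 4 else if j < k + 3 then 6 * r + 6
      else if j < k + 6 then r ^ 2 else r ^ 2 + 2 * r) ?_ ?_
  · intro i j
    simp only [EPgraph, compl_adj, fromRel_adj, ne_eq, Fin.ext_iff, Nat.reduceSubDiff]
    exact and_congr_right fun h => not_congr (and_iff_right h)
  · intro i _
    split_ifs <;> positivity
  · intro i hi
    rw [sum_range_add_nine k _ (if i < k + 3 then 0 else 6 * r + 6)]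
    · have hcases : i = 0 ∨ i = 1 ∨ i = 2 ∨ (3 ≤ i ∧ i < k + 3) ∨ i = k + 3 ∨ i = k + 4 ∨
        i = k + 5 ∨ i = k + 6 ∨ i = k + 7 ∨ i = k + 8 := by omega
      rcases hcases with h | h | h | h | h | h | h | h | h | h <;>
      · simp (disch := omega) only [if_pos, if_neg]
        linarith
    · intro t ht
      by_cases hik : i < k + 3 <;> simp (disch := omega) only [if_pos, if_neg]

theorem adjSpectralRadius_compl_EP'graph (k : ℕ) {r : ℝ} (hr : 0 < r)
    (hC : 0 < r ^ 2 - r - 6 - 4 * k)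
    (hroot : (r ^ 2 - r - 6 - 4 * k) * (r ^ 2 - r - 6 - 2 * k) - 2 * (r + 4 + 2 * k) ^ 2 = 0) :
    adjSpectralRadius (EP'graph (k + 9))ᶜ = r := by
  set P : ℝ := r + 4 + 2 * k with hP
  set C : ℝ := r ^ 2 - r - 6 - 4 * k with hCdef
  have hPpos : 0 < P := by positivity
  refine adjSpectralRadius_eq_of_range_sum (by omega) _
    (fun i j => i ≠ j ∧ ¬ (((i < k + 3 ∧ j < k + 3) ∨
      (i = 0 ∧ (j = k + 3 ∨ j = k + 4)) ∨
      (i = 1 ∧ (j = k + 5 ∨ j = k + 6)) ∨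
      (i = k + 3 ∧ (j = k + 4 ∨ j = k + 5 ∨ j = k + 7)) ∨
      (i = k + 4 ∧ (j = k + 6 ∨ j = k + 8)) ∨
      (i = k + 5 ∧ (j = k + 6 ∨ j = k + 7)) ∨
      (i = k + 6 ∧ j = k + 8)) ∨
      ((j < k + 3 ∧ i < k + 3) ∨
      (j = 0 ∧ (i = k + 3 ∨ i = k + 4)) ∨
      (j = 1 ∧ (i = k + 5 ∨ i = k + 6)) ∨
      (j = k + 3 ∧ (i = k + 4 ∨ i = k + 5 ∨ i = k + 7)) ∨
      (j = k + 4 ∧ (i = k + 6 ∨ i = k + 8)) ∨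
      (j = k + 5 ∧ (i = k + 6 ∨ i = k + 7)) ∨
      (j = k + 6 ∧ i = k + 8)))) ?_
    (w := fun j => if j < 2 then 2 * P + 2 * C else if j < k + 3 then 4 * P + 2 * C
      else if j < k + 7 then r * P else r * C) ?_ ?_
  · intro i j
    simp only [EP'graph, compl_adj, fromRel_adj, ne_eq, Fin.ext_iff, Nat.reduceSubDiff]
    exact and_congr_right fun h => not_congr (and_iff_right h)
  · intro i _
    split_ifs <;> positivity
  · have hrowP : r * (r * P) = r * P + r * C + (2 * P + 2 * C) + (k + 1) * (4 * P + 2 * C) := by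
      rw [hP, hCdef]; ring
    have hrowC : r * (r * C) =
        2 * (r * P) + r * C + 2 * (2 * P + 2 * C) + (k + 1) * (4 * P + 2 * C) := by
      rw [hP, hCdef] at *
      linear_combination hroot
    intro i hi
    rw [sum_range_add_nine k _ (if i < k + 3 then 0 else 4 * P + 2 * C)]
    · have hcases : i = 0 ∨ i = 1 ∨ i = 2 ∨ (3 ≤ i ∧ i < k + 3) ∨ i = k + 3 ∨ i = k + 4 ∨
        i = k + 5 ∨ i = k + 6 ∨ i = k + 7 ∨ i = k + 8 := by omega
      rcases hcases with rfl | rfl | rfl | h | rfl | rfl | rfl | rfl | rfl | rfl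
      case inr.inr.inr.inl =>
        simp (disch := omega) only [if_pos, if_neg]
        linarith
      all_goals
        simp
        linarith
    · intro t ht
      by_cases hik : i < k + 3 <;> simp (disch := omega) only [if_pos, if_neg]

theorem adjSpectralRadius_K6JoinEmpty (k : ℕ) {r : ℝ} (hr : 0 < r)
    (hroot : r ^ 2 = 5 * r + 6 * k) :
    adjSpectralRadius (K6JoinEmpty (k + 6)) = r := by
  refine adjSpectralRadius_eq_of_range_sum (by omega) _
    (fun i j => i ≠ j ∧ (i < 6 ∨ j < 6)) ?_ (w := fun j => if j < 6 then r else 6) ?_ ?_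
  · intro i j
    simp only [K6JoinEmpty, fromRel_adj, ne_eq, Fin.ext_iff]
    omega
  · intro i _
    split_ifs <;> positivity
  · intro i hi
    have hmid : ∑ t ∈ Finset.range k, (if i ≠ t + 6 ∧ (i < 6 ∨ t + 6 < 6) then
        (if t + 6 < 6 then r else 6) else 0) = k * (if i < 6 then 6 else 0) := by
      rw [Finset.sum_congr rfl (g := fun _ => if i < 6 then (6 : ℝ) else 0)]
      · simp
      · intro t _
        split_ifs <;> first | rfl | omega
    simp only [Finset.sum_range_succ', add_assoc, Nat.reduceAdd, zero_add]
    rw [hmid]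
    have hcases : i = 0 ∨ i = 1 ∨ i = 2 ∨ i = 3 ∨ i = 4 ∨ i = 5 ∨ 6 ≤ i := by omega
    rcases hcases with h | h | h | h | h | h | h <;>
    · simp (disch := omega) only [if_pos, if_neg]
      linarith

theorem exists_root_between {f : ℝ → ℝ} (hf : Continuous f) {a b : ℝ} (hab : a < b)
    (ha : f a < 0) (hb : 0 < f b) : ∃ r, a < r ∧ r < b ∧ f r = 0 := by
  obtain ⟨r, ⟨h1, h2⟩, h3⟩ := intermediate_value_Ioo hab.le hf.continuousOn ⟨ha, hb⟩
  exact ⟨r, h1, h2, h3⟩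

/-- An upper bound for the square of a positive root of the quotient polynomial of
`(EPgraph (k + 9))ᶜ`. -/
theorem sq_lt_of_root {k r : ℝ} (hk : 1 ≤ k) (hr : 0 < r)
    (hroot : r ^ 3 - 2 * r ^ 2 - (6 * k + 12) * r - (6 * k + 8) = 0) :
    r ^ 2 < 4 * (k + 1) * (r + 1) := by
  by_contra! h
  have h4 : 4 * (k + 1) ≤ r := by
    by_contra! hlt
    nlinarith [mul_lt_mul_of_pos_left hlt hr]
  have hq : 0 ≤ r * (r - 4 * (k + 1)) := mul_nonneg hr.le (by linarith)
  have h30 : 30 ≤ r ^ 2 - 2 * r - (6 * k + 12) := by nlinarith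
  nlinarith [mul_le_mul_of_nonneg_left h30 hr.le]

theorem statement_12 (n : ℕ) (hn : 10 ≤ n) :
    adjSpectralRadius (EP'graph n)ᶜ < adjSpectralRadius (EPgraph n)ᶜ ∧
    adjSpectralRadius (EPgraph n)ᶜ < adjSpectralRadius (K6JoinEmpty n) ∧
    adjSpectralRadius (K6JoinEmpty n) = (5 + Real.sqrt (24 * (n : ℝ) - 119)) / 2 := by
  obtain ⟨k, rfl⟩ : ∃ k, n = k + 9 := ⟨n - 9, by omega⟩
  have hk : (1 : ℝ) ≤ k := by exact_mod_cast (by omega : 1 ≤ k)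
  push_cast
  set s : ℝ := √(24 * ((k : ℝ) + 9) - 119) with hs
  have hs2 : s ^ 2 = 24 * ((k : ℝ) + 9) - 119 := Real.sq_sqrt (by linarith)
  have hs0 : 0 ≤ s := Real.sqrt_nonneg _
  set u : ℝ := √(16 * (k : ℝ) + 25) with hu
  have hu2 : u ^ 2 = 16 * (k : ℝ) + 25 := Real.sq_sqrt (by linarith)
  have hu0 : 0 ≤ u := Real.sqrt_nonneg _
  have hus : u < s := by nlinarith
  obtain ⟨m, hm⟩ : ∃ m, m = (5 + s) / 2 := ⟨_, rfl⟩
  obtain ⟨l, hl⟩ : ∃ l, l = (1 + u) / 2 := ⟨_, rfl⟩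
  have hm2 : m ^ 2 = 5 * m + 6 * (k + 3) := by rw [hm]; linarith
  have hl2 : l ^ 2 = l + 6 + 4 * k := by rw [hl]; linarith
  have hl0 : 0 < l := by rw [hl]; positivity
  have hlm : l < m := by linarith
  have hm0 : 0 < m := hl0.trans hlm
  rw [← hm]
  have hK : adjSpectralRadius (K6JoinEmpty (k + 9)) = m :=
    adjSpectralRadius_K6JoinEmpty (k + 3) hm0 (by push_cast; exact hm2)
  obtain ⟨r, hlr, hrm, hr⟩ := exists_root_between
    (f := fun x => x ^ 3 - 2 * x ^ 2 - (6 * k + 12) * x - (6 * k + 8)) (by fun_prop) hlm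
    (by
      have h3 : l ^ 3 = l * (l + 6 + 4 * k) := by rw [← hl2]; ring
      nlinarith [mul_pos hl0 hl0])
    (by
      have h3 : m ^ 3 = m * (5 * m + 6 * (k + 3)) := by rw [← hm2]; ring
      nlinarith)
  have hr0 : 0 < r := hl0.trans hlr
  have hlt := sq_lt_of_root hk hr0 hr
  obtain ⟨q, hlq, hqr, hq⟩ := exists_root_between
    (f := fun x => (x ^ 2 - x - 6 - 4 * k) * (x ^ 2 - x - 6 - 2 * k) - 2 * (x + 4 + 2 * k) ^ 2)
    (by fun_prop) hlr
    (by
      have h0 : l ^ 2 - l - 6 - 4 * k = 0 := by linarith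
      have hp : 0 < (l + 4 + 2 * k) ^ 2 := by positivity
      rw [h0]
      linarith)
    (by
      linear_combination hlt - r * hr)
  have hl1 : 1 < l := by nlinarith
  have hC : 0 < q ^ 2 - q - 6 - 4 * k := by
    linear_combination mul_pos (sub_pos.2 hlq) (by linarith : 0 < q + l - 1) - hl2
  rw [hK, adjSpectralRadius_compl_EPgraph k hr0 hr,
    adjSpectralRadius_compl_EP'graph k (hl0.trans hlq) hC hq]
  exact ⟨hqr, hrm, rfl⟩
end

section
/- Let G be a closed claw-free graph and let C be a maximum clique of G. Then every vertex of G not in C has at most one neighbor in C. -/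
open SimpleGraph

/-- In a claw-free graph, a vertex whose neighbourhood contains two nonadjacent vertices with a
common neighbour in it is eligible. -/
theorem ClawFree.eligible_of_adj {V : Type*} {G : SimpleGraph V} (hclaw : ClawFree G)
    {x v y z : V} (hxv : G.Adj x v) (hxy : G.Adj x y) (hxz : G.Adj x z)
    (hvy : G.Adj v y) (hyz : G.Adj y z) (hne : v ≠ z) (hvz : ¬ G.Adj v z) :
    Eligible G x := by
  refine ⟨?_, v, z, hxv, hxz, hne, hvz⟩
  rw [SimpleGraph.connected_iff_exists_forall_reachable]
  have adj_reachable {a b : V} (ha : G.Adj x a) (hb : G.Adj x b) (h : G.Adj a b) :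
      (G.induce (G.neighborSet x)).Reachable ⟨a, ha⟩ ⟨b, hb⟩ :=
    SimpleGraph.Adj.reachable (SimpleGraph.induce_adj.mpr h)
  have hv := adj_reachable hxv hxy hvy
  have hz := hv.trans (adj_reachable hxy hxz hyz)
  refine ⟨⟨v, hxv⟩, ?_⟩
  rintro ⟨w, hw⟩
  by_cases hwv : v = w
  · subst hwv
    exact SimpleGraph.Reachable.refl _
  by_cases hwz : z = w
  · subst hwz
    exact hz
  by_cases hv' : G.Adj v w
  · exact adj_reachable hxv hw hv'
  by_cases hz' : G.Adj z w
  · exact hz.trans (adj_reachable hxz hw hz')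
  exact (hclaw ⟨x, v, z, w, hne, hwv, hwz, hxv, hxz, hw, hvz, hv', hz'⟩).elim

theorem statement_19 {V : Type*} [Fintype V] (G : SimpleGraph V)
    (hclosed : IsClosedGraph G) (hclaw : ClawFree G) (C : Finset V)
    (hC : G.IsClique (C : Set V))
    (hmax : ∀ D : Finset V, G.IsClique (D : Set V) → D.card ≤ C.card) :
    ∀ v : V, v ∉ C → ((C : Set V) ∩ G.neighborSet v).ncard ≤ 1 := by
  intro v hv
  classical
  rw [Set.ncard_le_one_iff]
  rintro x y ⟨hxC, hvx : G.Adj v x⟩ ⟨hyC, hvy : G.Adj v y⟩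
  by_contra hxy
  obtain ⟨z, hzC, hvz⟩ : ∃ z ∈ C, ¬ G.Adj v z := by
    by_contra! h
    have hD := hmax (insert v C) (by
      rw [Finset.coe_insert]
      exact hC.insert fun b hb _ => h b hb)
    rw [Finset.card_insert_of_notMem hv] at hD
    omega
  have hxz : x ≠ z := by rintro rfl; exact hvz hvx
  have hyz : y ≠ z := by rintro rfl; exact hvz hvy
  have hne : v ≠ z := by rintro rfl; exact hv hzC
  exact hclosed x (hclaw.eligible_of_adj hvx.symm (hC hxC hyC hxy) (hC hxC hzC hxz) hvy
    (hC hyC hzC hyz) hne hvz)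
end
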